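/- arXiv:0912.2795 — 2 statements merged into one kernel-verified Lean document; each statement's English description precedes it below -/
import Mathlib

section
/- Let X₁ have distribution function F with E X₁ = 0, E X₁² = 1, β³ = E|X₁|³ < ∞, let f be its characteristic function, f_n(t) = (f(t/√n))ⁿ, ℓ_n = β³/√n + 1/√n. Then for every n ≥ 1 and every t ∈ ℝ: |f_n(t)| ≤ [1 − (2/n) χ(t, ℓ_n)]^{n/2}, where χ(t,ε) = t²/2 − κ ε |t|³ for |t| ≤ θ₀/ε, χ(t,ε) = (1 − cos(εt))/ε² for θ₀ < ε|t| ≤ 2π, and χ(t,ε) = 0 for |t| > 2π/ε. -/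
open MeasureTheory ProbabilityTheory

/-- `κ = sup_{x>0} |cos x − 1 + x²/2| / x³ = 0.09916191…`. -/
noncomputable def kappa : ℝ :=
  ⨆ x : Set.Ioi (0 : ℝ), |Real.cos x - 1 + (x : ℝ) ^ 2 / 2| / (x : ℝ) ^ 3

/-- The Prawitz majorant function `χ(t, ε)`: `χ(t,ε) = t²/2 − κ ε |t|³` for `|t| ≤ θ₀/ε`,
`χ(t,ε) = (1 − cos(εt))/ε²` for `θ₀ < ε|t| ≤ 2π`, and `χ(t,ε) = 0` for `|t| > 2π/ε`. -/
noncomputable def chi (θ₀ κ t ε : ℝ) : ℝ :=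
  if |t| ≤ θ₀ / ε then t ^ 2 / 2 - κ * ε * |t| ^ 3
  else if ε * |t| ≤ 2 * Real.pi then (1 - Real.cos (ε * t)) / ε ^ 2
  else 0

/-- A level that is at most `sin` at `x`, at least `sin` at `y` and strictly below `sin` at `z`,
for `0 < x < y < z < 2π`, is negative. -/
lemma neg_of_sin_pattern {x y z c : ℝ} (hx : 0 < x) (hxy : x < y) (hyz : y < z)
    (hz : z < 2 * Real.pi) (hsx : c ≤ Real.sin x) (hsy : Real.sin y ≤ c)
    (hsz : c < Real.sin z) : c < 0 := by
  by_contra! hc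
  have hzpi : z < Real.pi := by
    by_contra! h
    have h1 : 0 ≤ Real.sin (z - Real.pi) :=
      Real.sin_nonneg_of_nonneg_of_le_pi (by linarith) (by linarith)
    rw [Real.sin_sub_pi] at h1
    linarith
  have hslope := strictConcaveOn_sin_Icc.slope_anti_adjacent
    (show x ∈ Set.Icc 0 Real.pi from ⟨hx.le, by linarith⟩)
    (show z ∈ Set.Icc 0 Real.pi from ⟨by linarith, hzpi.le⟩) hxy hyz
  have h1 : 0 < (Real.sin z - Real.sin y) / (z - y) := div_pos (by linarith) (by linarith)
  have h2 : (Real.sin y - Real.sin x) / (y - x) ≤ 0 :=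
    div_nonpos_of_nonpos_of_nonneg (by linarith) (by linarith)
  linarith

/-- The mean value theorem on `[a, b]`, with the value of the derivative cleared of fractions. -/
lemma exists_deriv_mul_eq_sub {g g' : ℝ → ℝ} (hg : ∀ x, HasDerivAt g (g' x) x) {a b : ℝ}
    (hab : a < b) : ∃ c, a < c ∧ c < b ∧ g' c * (b - a) = g b - g a := by
  obtain ⟨c, hc, h⟩ := exists_hasDerivAt_eq_slope g g' hab
    (fun x _ => (hg x).continuousAt.continuousWithinAt) (fun x _ => hg x)
  exact ⟨c, hc.1, hc.2, by rw [h, div_mul_cancel₀ _ (sub_pos.2 hab).ne']⟩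

lemma exists_deriv_neg {g g' : ℝ → ℝ} (hg : ∀ x, HasDerivAt g (g' x) x) {a b : ℝ}
    (hab : a < b) (h : g b < g a) : ∃ c, a < c ∧ c < b ∧ g' c < 0 := by
  obtain ⟨c, h1, h2, h3⟩ := exists_deriv_mul_eq_sub hg hab
  exact ⟨c, h1, h2, by nlinarith⟩

lemma exists_deriv_pos {g g' : ℝ → ℝ} (hg : ∀ x, HasDerivAt g (g' x) x) {a b : ℝ}
    (hab : a < b) (h : g a < g b) : ∃ c, a < c ∧ c < b ∧ 0 < g' c := by
  obtain ⟨c, h1, h2, h3⟩ := exists_deriv_mul_eq_sub hg hab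
  exact ⟨c, h1, h2, by nlinarith⟩

lemma exists_deriv_nonpos {g g' : ℝ → ℝ} (hg : ∀ x, HasDerivAt g (g' x) x) {a b : ℝ}
    (hab : a < b) (h : g b ≤ g a) : ∃ c, a < c ∧ c < b ∧ g' c ≤ 0 := by
  obtain ⟨c, h1, h2, h3⟩ := exists_deriv_mul_eq_sub hg hab
  exact ⟨c, h1, h2, by nlinarith⟩

lemma exists_deriv_eq_zero_of_eq {g g' : ℝ → ℝ} (hg : ∀ x, HasDerivAt g (g' x) x) {a b : ℝ}
    (hab : a < b) (h : g a = g b) : ∃ c, a < c ∧ c < b ∧ g' c = 0 := by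
  obtain ⟨c, h1, h2, h3⟩ := exists_deriv_mul_eq_sub hg hab
  exact ⟨c, h1, h2, by simpa [h, (sub_pos.2 hab).ne'] using h3⟩

/-- If the cubic `A x² - B x³` with `A ≤ 1/2`, `B ≥ 0` touches `1 - cos` at a point
`u ∈ (0, 2π]`, then it minorizes `1 - cos` on the positive half-line. -/
lemma cubic_le_one_sub_cos_of_tangent {A B u : ℝ} (hA : A ≤ 1 / 2) (hB : 0 ≤ B) (hu : 0 < u)
    (hu2 : u ≤ 2 * Real.pi) (h0 : 1 - Real.cos u - A * u ^ 2 + B * u ^ 3 = 0)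
    (h1 : Real.sin u - 2 * A * u + 3 * B * u ^ 2 = 0) {x : ℝ} (hx : 0 ≤ x) :
    A * x ^ 2 - B * x ^ 3 ≤ 1 - Real.cos x := by
  set g : ℝ → ℝ := fun x => 1 - Real.cos x - A * x ^ 2 + B * x ^ 3 with hg
  set g₁ : ℝ → ℝ := fun x => Real.sin x - 2 * A * x + 3 * B * x ^ 2 with hg₁
  set g₂ : ℝ → ℝ := fun x => Real.cos x - 2 * A + 6 * B * x with hg₂
  set g₃ : ℝ → ℝ := fun x => - Real.sin x + 6 * B with hg₃
  have d1 : ∀ x, HasDerivAt g (g₁ x) x := fun x => by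
    refine ((((Real.hasDerivAt_cos x).const_sub 1).sub ((hasDerivAt_pow 2 x).const_mul A)).add
      ((hasDerivAt_pow 3 x).const_mul B)).congr_deriv ?_
    simp only [hg₁]
    push_cast
    ring
  have d2 : ∀ x, HasDerivAt g₁ (g₂ x) x := fun x => by
    refine (((Real.hasDerivAt_sin x).sub ((hasDerivAt_id x).const_mul (2 * A))).add
      ((hasDerivAt_pow 2 x).const_mul (3 * B))).congr_deriv ?_
    simp only [hg₂]
    push_cast
    ring
  have d3 : ∀ x, HasDerivAt g₂ (g₃ x) x := fun x => by
    refine (((Real.hasDerivAt_cos x).sub_const (2 * A)).add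
      ((hasDerivAt_id x).const_mul (6 * B))).congr_deriv ?_
    simp only [hg₃, mul_one]
  have z0 : g 0 = 0 := by simp [hg]
  have z1 : g₁ 0 = 0 := by simp [hg₁]
  have z2 : 0 ≤ g₂ 0 := by simp [hg₂]; linarith
  have y0 : g u = 0 := h0
  have y1 : g₁ u = 0 := h1
  have key : ∀ x, 0 ≤ x → x ≤ 2 * Real.pi → 0 ≤ g x := by
    intro x hx hx2
    by_contra! hneg
    have hx0 : 0 < x := lt_of_le_of_ne hx (by rintro rfl; linarith)
    have no_pattern : ∀ p q r, 0 < p → p < q → q < r → r < 2 * Real.pi →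
        g₃ p ≤ 0 → 0 ≤ g₃ q → g₃ r < 0 → False := by
      intro p q r hp hpq hqr hr h1 h2 h3
      simp only [hg₃] at h1 h2 h3
      have := neg_of_sin_pattern (c := 6 * B) hp hpq hqr hr (by linarith) (by linarith)
        (by linarith)
      linarith
    rcases lt_trichotomy x u with hxu | rfl | hxu
    · obtain ⟨a, a1, a2, a3⟩ := exists_deriv_neg d1 hx0 (by linarith)
      obtain ⟨b, b1, b2, b3⟩ := exists_deriv_pos d1 hxu (by linarith)
      obtain ⟨p, p1, p2, p3⟩ := exists_deriv_neg d2 a1 (by linarith)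
      obtain ⟨q, q1, q2, q3⟩ := exists_deriv_pos d2 (a2.trans b1) (by linarith)
      obtain ⟨r, r1, r2, r3⟩ := exists_deriv_neg d2 b2 (by linarith)
      obtain ⟨i, i1, i2, i3⟩ := exists_deriv_neg d3 p1 (by linarith)
      obtain ⟨j, j1, j2, j3⟩ := exists_deriv_pos d3 (p2.trans q1) (by linarith)
      obtain ⟨k, k1, k2, k3⟩ := exists_deriv_neg d3 (q2.trans r1) (by linarith)
      exact no_pattern i j k i1 (i2.trans j1) (j2.trans k1) (by linarith) i3.le j3.le k3
    · linarith
    · obtain ⟨a, a1, a2, a3⟩ := exists_deriv_eq_zero_of_eq d1 hu (by linarith)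
      obtain ⟨b, b1, b2, b3⟩ := exists_deriv_neg d1 hxu (by linarith)
      obtain ⟨p, p1, p2, p3⟩ := exists_deriv_eq_zero_of_eq d2 a1 (by linarith)
      obtain ⟨q, q1, q2, q3⟩ := exists_deriv_eq_zero_of_eq d2 a2 (by linarith)
      obtain ⟨r, r1, r2, r3⟩ := exists_deriv_neg d2 b1 (by linarith)
      obtain ⟨i, i1, i2, i3⟩ := exists_deriv_nonpos d3 p1 (by linarith)
      obtain ⟨j, j1, j2, j3⟩ := exists_deriv_eq_zero_of_eq d3 (p2.trans q1) (by linarith)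
      obtain ⟨k, k1, k2, k3⟩ := exists_deriv_neg d3 (q2.trans r1) (by linarith)
      exact no_pattern i j k i1 (i2.trans j1) (j2.trans k1) (by linarith) i3 j3.ge k3
  rcases le_total x (2 * Real.pi) with hx2 | hx2
  · have := key x hx hx2
    simp only [hg] at this
    linarith
  · have hpi := Real.pi_pos
    have h2 := key (2 * Real.pi) (by positivity) le_rfl
    simp only [hg, Real.cos_two_pi] at h2
    have h3 : A - B * (2 * Real.pi) ≤ 0 := by
      by_contra! h
      have := mul_pos (show 0 < (2 * Real.pi) ^ 2 by positivity) h
      linarith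
    have h4 : A - B * x ≤ 0 := by nlinarith
    nlinarith [Real.cos_le_one x, mul_nonneg (sq_nonneg x) (neg_nonneg.2 h4)]

lemma monotoneOn_sq_add_two_mul_sin_add_cos :
    MonotoneOn (fun u : ℝ => u ^ 2 + 2 * u * Real.sin u + 6 * (Real.cos u - 1))
      (Set.Icc Real.pi (2 * Real.pi)) := by
  have hd : ∀ u : ℝ, HasDerivAt
      (fun u : ℝ => u ^ 2 + 2 * u * Real.sin u + 6 * (Real.cos u - 1))
      (2 * (u * (1 + Real.cos u) - 2 * Real.sin u)) u := fun u => by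
    refine (((hasDerivAt_pow 2 u).add
      (((hasDerivAt_id u).const_mul 2).mul (Real.hasDerivAt_sin u))).add
      (((Real.hasDerivAt_cos u).sub_const 1).const_mul 6)).congr_deriv ?_
    simp only [id]
    push_cast
    ring
  refine monotoneOn_of_deriv_nonneg (convex_Icc _ _)
    (fun u _ => (hd u).continuousAt.continuousWithinAt)
    (fun u _ => (hd u).differentiableAt.differentiableWithinAt) fun u hu => ?_
  rw [interior_Icc] at hu
  rw [(hd u).deriv]
  have hs : 0 ≤ Real.sin (u - Real.pi) :=
    Real.sin_nonneg_of_nonneg_of_le_pi (by linarith [hu.1]) (by linarith [hu.2])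
  rw [Real.sin_sub_pi] at hs
  have := mul_nonneg (Real.pi_pos.trans hu.1).le
    (show 0 ≤ 1 + Real.cos u by linarith [Real.neg_one_le_cos u])
  linarith

/-- For `u ∈ [θ₀, 2π]`, some cubic `A x² - B |x|³` minorizes `1 - cos` on the whole line,
with equality at `u`. -/
lemma exists_cubic_le_one_sub_cos {θ₀ : ℝ} (hθ₀ : θ₀ ∈ Set.Icc Real.pi (2 * Real.pi))
    (hroot : θ₀ ^ 2 + 2 * θ₀ * Real.sin θ₀ + 6 * (Real.cos θ₀ - 1) = 0)
    {u : ℝ} (hu : θ₀ ≤ u) (hu2 : u ≤ 2 * Real.pi) :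
    ∃ A B : ℝ, 0 ≤ B ∧ (∀ x, A * x ^ 2 - B * |x| ^ 3 ≤ 1 - Real.cos x) ∧
      A * u ^ 2 - B * u ^ 3 = 1 - Real.cos u := by
  have hpu : Real.pi ≤ u := hθ₀.1.trans hu
  have hu0 : 0 < u := Real.pi_pos.trans_le hpu
  have hphi : 0 ≤ u ^ 2 + 2 * u * Real.sin u + 6 * (Real.cos u - 1) :=
    hroot.symm.trans_le (monotoneOn_sq_add_two_mul_sin_add_cos hθ₀ ⟨hpu, hu2⟩ hu)
  have hs : 0 ≤ Real.sin (u - Real.pi) :=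
    Real.sin_nonneg_of_nonneg_of_le_pi (by linarith) (by linarith)
  rw [Real.sin_sub_pi] at hs
  set A : ℝ := (3 * (1 - Real.cos u) - u * Real.sin u) / u ^ 2 with hAdef
  set B : ℝ := (2 * (1 - Real.cos u) - u * Real.sin u) / u ^ 3 with hBdef
  have hA : A ≤ 1 / 2 := by
    rw [hAdef, div_le_iff₀ (by positivity)]
    linarith
  have hB : 0 ≤ B :=
    div_nonneg (by nlinarith [Real.cos_le_one u, mul_nonneg hu0.le hs]) (by positivity)
  have h0 : A * u ^ 2 - B * u ^ 3 = 1 - Real.cos u := by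
    rw [hAdef, hBdef]; field_simp; ring
  have h1 : Real.sin u - 2 * A * u + 3 * B * u ^ 2 = 0 := by
    rw [hAdef, hBdef]; field_simp; ring
  refine ⟨A, B, hB, fun x => ?_, h0⟩
  have := cubic_le_one_sub_cos_of_tangent hA hB hu0 hu2 (by linarith) h1 (abs_nonneg x)
  rwa [Real.cos_abs, sq_abs] at this

lemma bddAbove_cos_remainder_ratio : BddAbove (Set.range fun x : Set.Ioi (0 : ℝ) =>
    |Real.cos x - 1 + (x : ℝ) ^ 2 / 2| / (x : ℝ) ^ 3) := by
  refine ⟨1, ?_⟩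
  rintro _ ⟨⟨x, hx⟩, rfl⟩
  have hx : 0 < x := hx
  have h0 : 0 ≤ Real.cos x - 1 + x ^ 2 / 2 := by linarith [Real.one_sub_sq_div_two_le_cos (x := x)]
  simp only
  rw [abs_of_nonneg h0, div_le_one (by positivity)]
  rcases le_total x 1 with h | h
  · have hc := (abs_le.1 (Real.cos_bound (x := x) (by rwa [abs_of_pos hx]))).2
    rw [abs_of_pos hx] at hc
    have : x ^ 4 ≤ x ^ 3 := pow_le_pow_of_le_one hx.le h (by norm_num)
    have : 0 < x ^ 3 := by positivity
    linarith
  · have : x ^ 2 ≤ x ^ 3 := pow_le_pow_right₀ h (by norm_num)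
    have : 0 < x ^ 2 := by positivity
    linarith [Real.cos_le_one x]

lemma kappa_nonneg : 0 ≤ kappa :=
  Real.iSup_nonneg fun x => div_nonneg (abs_nonneg _) (pow_nonneg (le_of_lt x.2) 3)

lemma half_sq_sub_kappa_le_one_sub_cos (x : ℝ) :
    1 / 2 * x ^ 2 - kappa * |x| ^ 3 ≤ 1 - Real.cos x := by
  rcases eq_or_ne x 0 with rfl | hx
  · simp
  have hx' : 0 < |x| := abs_pos.2 hx
  have h := le_ciSup bddAbove_cos_remainder_ratio (⟨|x|, hx'⟩ : Set.Ioi (0 : ℝ))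
  change _ ≤ kappa at h
  simp only [Real.cos_abs, sq_abs] at h
  rw [div_le_iff₀ (by positivity)] at h
  linarith [le_abs_self (Real.cos x - 1 + x ^ 2 / 2)]

lemma norm_sq_integral_exp_eq (μ : Measure ℝ) [IsProbabilityMeasure μ] (s : ℝ) :
    ‖∫ x, Complex.exp (Complex.I * s * x) ∂μ‖ ^ 2 =
      (∫ x, Real.cos (s * x) ∂μ) ^ 2 + (∫ x, Real.sin (s * x) ∂μ) ^ 2 := by
  have hexp : ∀ x : ℝ, Complex.exp (Complex.I * s * x) =
      Complex.exp (((s * x : ℝ) : ℂ) * Complex.I) := fun x => by congr 1; push_cast; ring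
  have hi : Integrable (fun x : ℝ => Complex.exp (Complex.I * s * x)) μ := by
    refine (integrable_const (1 : ℝ)).mono' (by fun_prop) (ae_of_all _ fun x => ?_)
    rw [hexp, Complex.norm_exp_ofReal_mul_I]
  have hre : (∫ x, Complex.exp (Complex.I * s * x) ∂μ).re = ∫ x, Real.cos (s * x) ∂μ := by
    have h := Complex.reCLM.integral_comp_comm hi
    simp only [Complex.reCLM_apply] at h
    rw [← h]
    simp only [hexp, Complex.exp_ofReal_mul_I_re]
  have him : (∫ x, Complex.exp (Complex.I * s * x) ∂μ).im = ∫ x, Real.sin (s * x) ∂μ := by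
    have h := Complex.imCLM.integral_comp_comm hi
    simp only [Complex.imCLM_apply] at h
    rw [← h]
    simp only [hexp, Complex.exp_ofReal_mul_I_im]
  rw [Complex.sq_norm, Complex.normSq_apply, hre, him]
  ring

/-- A cubic minorant of `1 - cos` yields a bound for the squared modulus of the characteristic
function of a standardized distribution. -/
lemma norm_sq_integral_exp_le (μ : Measure ℝ) [IsProbabilityMeasure μ]
    (hmean : ∫ x, x ∂μ = 0) (hvar : ∫ x, x ^ 2 ∂μ = 1)
    (hint3 : Integrable (fun x => |x| ^ 3) μ) {A B : ℝ} (hB : 0 ≤ B)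
    (hAB : ∀ x, A * x ^ 2 - B * |x| ^ 3 ≤ 1 - Real.cos x) (s : ℝ) :
    ‖∫ x, Complex.exp (Complex.I * s * x) ∂μ‖ ^ 2 ≤
      1 - 2 * (A * s ^ 2 - B * |s| ^ 3 * ((∫ x, |x| ^ 3 ∂μ) + 1)) := by
  have hdom : Integrable (fun x : ℝ => 1 + |x| ^ 3) μ := (integrable_const 1).add hint3
  have i2 : Integrable (fun x : ℝ => x ^ 2) μ := by
    refine hdom.mono' (by fun_prop) (ae_of_all _ fun x => ?_)
    rw [Real.norm_of_nonneg (sq_nonneg x), ← sq_abs]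
    nlinarith [abs_nonneg x, sq_nonneg (|x| - 1), mul_nonneg (abs_nonneg x) (sq_nonneg (|x| - 1))]
  have ia : Integrable (fun x : ℝ => |x|) μ := by
    refine ((integrable_const (1 : ℝ)).add i2).mono' (by fun_prop) (ae_of_all _ fun x => ?_)
    simp only [Real.norm_eq_abs, abs_abs, Pi.add_apply]
    nlinarith [sq_abs x, sq_nonneg (|x| - 1)]
  have i1 : Integrable (fun x : ℝ => x) μ :=
    ia.mono' (by fun_prop) (ae_of_all _ fun x => le_rfl)
  have iM : Integrable (fun x : ℝ => x * |x|) μ := by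
    refine i2.mono' (by fun_prop) (ae_of_all _ fun x => ?_)
    simp only [Real.norm_eq_abs, abs_mul, abs_abs]
    rw [← sq, sq_abs]
  have ic : Integrable (fun x : ℝ => Real.cos (s * x)) μ :=
    (integrable_const (1 : ℝ)).mono' (by fun_prop) (ae_of_all _ fun x => Real.abs_cos_le_one _)
  have is : Integrable (fun x : ℝ => Real.sin (s * x)) μ :=
    (integrable_const (1 : ℝ)).mono' (by fun_prop) (ae_of_all _ fun x => Real.abs_sin_le_one _)
  have hlin : ∀ c : ℝ, ∫ x, c * x ∂μ = 0 := fun c => by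
    rw [integral_const_mul c fun x : ℝ => x, hmean, mul_zero]
  rw [norm_sq_integral_exp_eq]
  set β := ∫ x, |x| ^ 3 ∂μ
  set M := ∫ x, x * |x| ∂μ
  set m := ∫ x, |x| ∂μ
  set a := ∫ x, Real.cos (s * x) ∂μ
  set b := ∫ x, Real.sin (s * x) ∂μ
  have hm1 : m ≤ 1 := by
    have h : m ≤ ∫ x, (1 / 2 + 1 / 2 * x ^ 2) ∂μ :=
      integral_mono ia ((integrable_const _).add (i2.const_mul _)) fun x => by
        simp only
        nlinarith [sq_abs x, sq_nonneg (|x| - 1)]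
    rw [integral_add (integrable_const _) (i2.const_mul _), integral_const_mul, hvar] at h
    simp at h
    linarith
  set D := B * |s| ^ 3 with hD
  have hD0 : 0 ≤ D := by positivity
  have hpt : ∀ x y : ℝ, Real.cos (s * y) * Real.cos (s * x) + Real.sin (s * y) * Real.sin (s * x) ≤
      (1 - A * s ^ 2 * y ^ 2 + D * |y| ^ 3) + (D * |y| - A * s ^ 2) * x ^ 2
        + (2 * A * s ^ 2 * y - 2 * D * (y * |y|)) * x + D * |x| ^ 3 + (-(2 * D * y)) * (x * |x|)
        + D * y ^ 2 * |x| := by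
    intro x y
    have h := hAB (s * y - s * x)
    rw [Real.cos_sub, ← mul_sub, abs_mul, mul_pow, mul_pow] at h
    have h3 : |y - x| ^ 3 ≤ (|y| + |x|) * (y - x) ^ 2 := by
      rw [pow_succ', sq_abs]
      exact mul_le_mul_of_nonneg_right (abs_sub _ _) (sq_nonneg _)
    have h4 := mul_le_mul_of_nonneg_left h3 hD0
    have ex : |x| ^ 3 = |x| * x ^ 2 := by rw [pow_succ', sq_abs]
    have ey : |y| ^ 3 = |y| * y ^ 2 := by rw [pow_succ', sq_abs]
    rw [ex, ey]
    rw [hD] at h4 ⊢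
    linarith
  have hy : ∀ y : ℝ, a * Real.cos (s * y) + b * Real.sin (s * y) ≤
      (1 - A * s ^ 2 + D * β) + (D * m - A * s ^ 2) * y ^ 2 + D * |y| ^ 3 + D * |y|
        + (-(2 * D * M)) * y := by
    intro y
    have j0 := ic.const_mul (Real.cos (s * y))
    have j0' := is.const_mul (Real.sin (s * y))
    have j1 := integrable_const (μ := μ) (1 - A * s ^ 2 * y ^ 2 + D * |y| ^ 3)
    have j2 := i2.const_mul (D * |y| - A * s ^ 2)
    have j3 := i1.const_mul (2 * A * s ^ 2 * y - 2 * D * (y * |y|))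
    have j4 := hint3.const_mul D
    have j5 := iM.const_mul (-(2 * D * y))
    have j6 := ia.const_mul (D * y ^ 2)
    have h := integral_mono (j0.add j0') (((((j1.add j2).add j3).add j4).add j5).add j6)
      (fun x => hpt x y)
    rw [integral_add' j0 j0', integral_add' ((((j1.add j2).add j3).add j4).add j5) j6,
      integral_add' (((j1.add j2).add j3).add j4) j5, integral_add' ((j1.add j2).add j3) j4,
      integral_add' (j1.add j2) j3, integral_add' j1 j2] at h
    simp only [integral_const_mul, hlin, integral_const, probReal_univ, one_smul, hvar] at h
    linarith
  have j0 := ic.const_mul a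
  have j0' := is.const_mul b
  have j1 := integrable_const (μ := μ) (1 - A * s ^ 2 + D * β)
  have j2 := i2.const_mul (D * m - A * s ^ 2)
  have j3 := hint3.const_mul D
  have j4 := ia.const_mul D
  have j5 := i1.const_mul (-(2 * D * M))
  have h := integral_mono (j0.add j0') ((((j1.add j2).add j3).add j4).add j5) hy
  rw [integral_add' j0 j0', integral_add' (((j1.add j2).add j3).add j4) j5,
    integral_add' ((j1.add j2).add j3) j4, integral_add' (j1.add j2) j3,
    integral_add' j1 j2] at h
  simp only [integral_const_mul, hlin, integral_const, probReal_univ, one_smul, hvar] at h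
  nlinarith [mul_le_mul_of_nonneg_left hm1 hD0]

/-- First estimate of Lemma 2: for a distribution with zero mean, unit variance and third
absolute moment `β³`, with `ℓ_n = β³/√n + 1/√n`, the characteristic function `f_n` of the
normalized `n`-fold sum satisfies `|f_n(t)| ≤ [1 − (2/n) χ(t, ℓ_n)]^{n/2}`. -/
theorem charFun_bound_f1 (μ : Measure ℝ) [IsProbabilityMeasure μ]
    (hmean : ∫ x, x ∂μ = 0) (hvar : ∫ x, x ^ 2 ∂μ = 1)
    (hint3 : Integrable (fun x => |x| ^ 3) μ)
    (β3 : ℝ) (hβ3 : β3 = ∫ x, |x| ^ 3 ∂μ)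
    (f : ℝ → ℂ) (hf : ∀ t : ℝ, f t = ∫ x, Complex.exp (Complex.I * t * x) ∂μ)
    (θ₀ : ℝ) (hθ₀mem : θ₀ ∈ Set.Icc Real.pi (2 * Real.pi))
    (hθ₀root : θ₀ ^ 2 + 2 * θ₀ * Real.sin θ₀ + 6 * (Real.cos θ₀ - 1) = 0)
    (n : ℕ) (hn : 1 ≤ n) (t : ℝ) :
    ‖(f (t / Real.sqrt n)) ^ n‖ ≤
      (1 - (2 / n) * chi θ₀ kappa t (β3 / Real.sqrt n + 1 / Real.sqrt n)) ^ ((n : ℝ) / 2) := by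
  have hn0 : (0 : ℝ) < n := by exact_mod_cast hn
  set r := Real.sqrt n with hr
  have hr0 : 0 < r := Real.sqrt_pos.2 hn0
  have hrn : (n : ℝ) = r ^ 2 := (Real.sq_sqrt hn0.le).symm
  have hβ0 : 0 ≤ β3 := hβ3 ▸ integral_nonneg fun x => by positivity
  set ε := β3 / r + 1 / r with hε
  have hεr : ε = (β3 + 1) / r := by rw [hε]; ring
  have hε0 : 0 < ε := by rw [hεr]; positivity
  have habs : |t / r| = |t| / r := by rw [abs_div, abs_of_pos hr0]
  have key : ‖f (t / r)‖ ^ 2 ≤ 1 - 2 / n * chi θ₀ kappa t ε := by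
    have hbound {A B : ℝ} (hB : 0 ≤ B) (hAB : ∀ x, A * x ^ 2 - B * |x| ^ 3 ≤ 1 - Real.cos x) :
        ‖f (t / r)‖ ^ 2 ≤ 1 - 2 / n * (A * t ^ 2 - B * ε * |t| ^ 3) := by
      rw [hf]
      refine (norm_sq_integral_exp_le μ hmean hvar hint3 hB hAB (t / r)).trans_eq ?_
      rw [← hβ3, habs, hrn, hεr]
      field_simp
    unfold chi
    split_ifs with h1 h2
    · refine (hbound kappa_nonneg half_sq_sub_kappa_le_one_sub_cos).trans_eq ?_
      ring
    · rw [not_le, div_lt_iff₀ hε0] at h1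
      obtain ⟨A, B, hB, hAB, hu⟩ := exists_cubic_le_one_sub_cos hθ₀mem hθ₀root
        (u := ε * |t|) (by linarith) h2
      refine (hbound hB hAB).trans_eq ?_
      have hc : Real.cos (ε * t) = Real.cos (ε * |t|) := by
        rw [← Real.cos_abs (ε * t), abs_mul, abs_of_pos hε0]
      rw [hc, ← hu, mul_pow, mul_pow, sq_abs]
      field_simp
    · have h := hbound (A := 0) (B := 0) le_rfl fun x => by linarith [Real.cos_le_one x]
      simpa using h
  have hpow : ‖f (t / r) ^ n‖ = (‖f (t / r)‖ ^ 2) ^ ((n : ℝ) / 2) := by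
    rw [norm_pow, ← Real.rpow_natCast _ 2, ← Real.rpow_mul (norm_nonneg _),
      ← Real.rpow_natCast _ n]
    congr 1
    push_cast
    ring
  rw [hpow]
  exact Real.rpow_le_rpow (sq_nonneg _) key (by positivity)
end

section
/- (Tyurin's estimate.) Let X₁ have distribution function F with E X₁ = 0, E X₁² = 1, β³ = E|X₁|³ < ∞, let f be its characteristic function, f_n(t) = (f(t/√n))ⁿ, and ℓ = β³/√n. Then for every n ≥ 1 and every t ∈ ℝ: |f_n(t) − e^{−t²/2}| ≤ ℓ e^{−t²/2} ∫₀^{|t|} (u²/2) e^{u²/2} |f(u/√n)|^{n−1} du. -/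
open MeasureTheory ProbabilityTheory

lemma integral_abs_eq_mul_abs_div_two (x : ℝ) : ∫ w in (0 : ℝ)..x, |w| = x * |x| / 2 := by
  rcases le_total 0 x with hx | hx
  · have h : ∫ w in (0 : ℝ)..x, |w| = ∫ w in (0 : ℝ)..x, w :=
      intervalIntegral.integral_congr fun w hw => by
        rw [Set.uIcc_of_le hx] at hw
        exact abs_of_nonneg hw.1
    rw [h, integral_id, abs_of_nonneg hx]
    ring
  · have h : ∫ w in (0 : ℝ)..x, |w| = ∫ w in (0 : ℝ)..x, -w :=
      intervalIntegral.integral_congr fun w hw => by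
        rw [Set.uIcc_of_ge hx] at hw
        exact abs_of_nonpos hw.2
    rw [h, intervalIntegral.integral_neg, integral_id, abs_of_nonpos hx]
    ring

lemma integral_abs_eq_sub (x y : ℝ) :
    ∫ w in y..x, |w| = (x * |x| - y * |y|) / 2 := by
  have hint (a b : ℝ) : IntervalIntegrable (fun w : ℝ => |w|) volume a b :=
    continuous_abs.intervalIntegrable a b
  rw [← intervalIntegral.integral_interval_sub_left (hint 0 x) (hint 0 y),
    integral_abs_eq_mul_abs_div_two, integral_abs_eq_mul_abs_div_two]
  ring

lemma sub_mul_mul_abs_sub_nonneg (x y : ℝ) : 0 ≤ (x - y) * (x * |x| - y * |y|) := by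
  rcases abs_cases x with ⟨hx, hx'⟩ | ⟨hx, hx'⟩ <;>
  rcases abs_cases y with ⟨hy, hy'⟩ | ⟨hy, hy'⟩ <;> rw [hx, hy]
  · nlinarith [mul_nonneg (sq_nonneg (x - y)) (add_nonneg hx' hy')]
  · nlinarith [mul_nonneg (sub_nonneg.2 (hy'.le.trans hx'))
      (add_nonneg (sq_nonneg x) (sq_nonneg y))]
  · nlinarith [mul_nonneg (sub_nonneg.2 (hx'.le.trans hy'))
      (add_nonneg (sq_nonneg x) (sq_nonneg y))]
  · nlinarith [mul_nonneg (sq_nonneg (x - y)) (neg_nonneg.2 (add_neg hx' hy').le)]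

lemma hasDerivAt_exp_ofReal_mul_I (s x : ℝ) :
    HasDerivAt (fun w : ℝ => Complex.exp (s * w * Complex.I))
      (s * Complex.I * Complex.exp (s * x * Complex.I)) x := by
  have h := (((Complex.ofRealCLM.hasDerivAt (x := x)).const_mul (s : ℂ)).mul_const
    Complex.I).cexp
  convert! h using 1
  simp
  ring

lemma norm_exp_ofReal_mul_ofReal_mul_I (s x : ℝ) :
    ‖Complex.exp (s * x * Complex.I)‖ = 1 := by
  exact_mod_cast Complex.norm_exp_ofReal_mul_I (s * x)

/-- A pointwise estimate whose average over two independent copies of a standardized random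
variable bounds the Stein discrepancy of its characteristic function. -/
lemma norm_stein_kernel_exp_le (s x y : ℝ) :
    ‖((x : ℂ) - y) * (Complex.exp (s * x * Complex.I) - Complex.exp (s * y * Complex.I) +
        y * (s * Complex.I * Complex.exp (s * x * Complex.I)) -
        x * (s * Complex.I * Complex.exp (s * y * Complex.I)))‖ ≤
      s ^ 2 * ((x - y) * (x * |x| - y * |y|) / 2) := by
  set h : ℝ → ℂ := fun w => Complex.exp (s * w * Complex.I)
  have hd (w : ℝ) : HasDerivAt h (s * Complex.I * h w) w := hasDerivAt_exp_ofReal_mul_I s w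
  have hcont : Continuous h := by fun_prop
  have hD (w : ℝ) : HasDerivAt
      (fun w : ℝ => ((x : ℂ) + y - w) * (s * Complex.I * h w) + h w)
      (((x : ℂ) + y - w) * (-s ^ 2 * h w)) w := by
    have h1 : HasDerivAt (fun w : ℝ => (x : ℂ) + y - w) (-1) w := by
      simpa using (Complex.ofRealCLM.hasDerivAt (x := w)).const_sub ((x : ℂ) + y)
    convert! (h1.mul ((hd w).const_mul (s * Complex.I))).add (hd w) using 1
    linear_combination -(((x : ℂ) + y - w) * s ^ 2 * h w) * Complex.I_sq
  have hFTC := intervalIntegral.integral_eq_sub_of_hasDerivAt (a := y) (b := x)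
    (fun w _ => hD w) (Continuous.intervalIntegrable (by fun_prop) _ _)
  have hkernel : h x - h y + y * (s * Complex.I * h x) - x * (s * Complex.I * h y) =
      ∫ w in y..x, ((x : ℂ) + y - w) * (-s ^ 2 * h w) := by
    rw [hFTC]
    ring
  have hnorm : ‖h x - h y + y * (s * Complex.I * h x) - x * (s * Complex.I * h y)‖ ≤
      s ^ 2 * |(x * |x| - y * |y|) / 2| := by
    rw [hkernel]
    refine intervalIntegral.norm_integral_le_abs_integral_norm.trans_eq ?_
    have hpt (w : ℝ) : ‖((x : ℂ) + y - w) * (-s ^ 2 * h w)‖ = s ^ 2 * |x + y - w| := by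
      have h1 : ‖(x : ℂ) + y - w‖ = |x + y - w| := by
        exact_mod_cast Complex.norm_real (x + y - w)
      rw [norm_mul, norm_mul, norm_neg, norm_pow, Complex.norm_real, Real.norm_eq_abs, sq_abs,
        h1, norm_exp_ofReal_mul_ofReal_mul_I]
      ring
    simp_rw [hpt]
    rw [intervalIntegral.integral_const_mul, abs_mul, abs_of_nonneg (sq_nonneg s),
      intervalIntegral.integral_comp_sub_left (fun w => |w|), add_sub_cancel_left,
      add_sub_cancel_right, integral_abs_eq_sub]
  have hxy : ‖(x : ℂ) - y‖ = |x - y| := by exact_mod_cast Complex.norm_real (x - y)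
  rw [norm_mul, hxy]
  calc _ ≤ |x - y| * (s ^ 2 * |(x * |x| - y * |y|) / 2|) := by gcongr
    _ = s ^ 2 * |(x - y) * ((x * |x| - y * |y|) / 2)| := by rw [abs_mul]; ring
    _ = _ := by
      rw [abs_of_nonneg (by linarith [sub_mul_mul_abs_sub_nonneg x y])]
      ring

section Moments

variable {μ : Measure ℝ} [IsProbabilityMeasure μ]

lemma integrable_abs_pow_of_le_three (hint3 : Integrable (fun x => |x| ^ 3) μ) {k : ℕ}
    (hk : k ≤ 3) : Integrable (fun x => |x| ^ k) μ :=
  integrable_norm_pow_of_le (f := id) (by fun_prop) hk hint3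

/-- A standardized random variable has Stein discrepancy at most `E|X|³ / 2` on the functions
`x ↦ exp (i s x)`. -/
lemma norm_integral_mul_exp_sub_le
    (hmean : ∫ x, x ∂μ = 0) (hvar : ∫ x, x ^ 2 ∂μ = 1)
    (hint3 : Integrable (fun x => |x| ^ 3) μ) (s : ℝ) :
    ‖(∫ x : ℝ, x * Complex.exp (s * x * Complex.I) ∂μ) - s * Complex.I * charFun μ s‖ ≤
      s ^ 2 * ((∫ x, |x| ^ 3 ∂μ) / 2) := by
  have i1 : Integrable (fun x : ℝ => x) μ := by
    refine (integrable_abs_pow_of_le_three hint3 (k := 1) (by norm_num)).mono' (by fun_prop) ?_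
    simp
  have i2 : Integrable (fun x : ℝ => x ^ 2) μ := by
    simpa using integrable_abs_pow_of_le_three hint3 (k := 2) (by norm_num)
  have i2' : Integrable (fun x : ℝ => x * |x|) μ := by
    refine i2.mono (by fun_prop) ?_
    simp [sq]
  have c1 : Integrable (fun x : ℝ => (x : ℂ)) μ := i1.ofReal
  have c2 : Integrable (fun x : ℝ => (x : ℂ) ^ 2) μ := by exact_mod_cast i2.ofReal (𝕜 := ℂ)
  have e1 : ∫ x : ℝ, (x : ℂ) ∂μ = 0 := by rw [integral_complex_ofReal, hmean]; simp
  have e2 : ∫ x : ℝ, (x : ℂ) ^ 2 ∂μ = 1 := by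
    have : ∫ x : ℝ, ((x ^ 2 : ℝ) : ℂ) ∂μ = 1 := by rw [integral_complex_ofReal, hvar]; simp
    exact_mod_cast this
  set h : ℝ → ℂ := fun w => Complex.exp (s * w * Complex.I)
  have hcont : Continuous h := by fun_prop
  have hnorm (w : ℝ) : ‖h w‖ = 1 := norm_exp_ofReal_mul_ofReal_mul_I s w
  have ch : Integrable h μ :=
    (integrable_const (1 : ℝ)).mono' hcont.aestronglyMeasurable (by simp [hnorm])
  have c1h : Integrable (fun x : ℝ => (x : ℂ) * h x) μ :=
    c1.norm.mono' (by fun_prop) (by simp [hnorm])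
  rw [charFun_apply_real]
  change ‖(∫ x : ℝ, x * h x ∂μ) - s * Complex.I * ∫ x : ℝ, h x ∂μ‖ ≤ _
  set m := ∫ x : ℝ, x * h x ∂μ with hm
  set φ := ∫ x : ℝ, h x ∂μ with hφ
  set β := ∫ x, |x| ^ 3 ∂μ with hβ
  set c := ∫ x, x * |x| ∂μ with hc
  let K : ℝ → ℝ → ℂ := fun x y =>
    ((x : ℂ) - y) * (h x - h y + y * (s * Complex.I * h x) - x * (s * Complex.I * h y))
  have hK (x y : ℝ) : ‖K x y‖ ≤ s ^ 2 * ((x - y) * (x * |x| - y * |y|) / 2) :=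
    norm_stein_kernel_exp_le s x y
  have hinner (y : ℝ) : ∫ x, K x y ∂μ =
      (m * (1 + s * Complex.I * y) + y * h y) - (y * φ + y ^ 2 * (s * Complex.I * φ) +
        s * Complex.I * h y) := by
    have hexp (x : ℝ) : K x y =
        x * h x * (1 + s * Complex.I * y) + y * h y
          + h x * (-y - y ^ 2 * (s * Complex.I)) + x * (-h y + y * (s * Complex.I * h y))
          + x ^ 2 * (-(s * Complex.I * h y)) := by
      simp only [K]
      ring
    simp_rw [hexp]
    rw [integral_add, integral_add, integral_add, integral_add]
    · simp_rw [integral_mul_const]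
      rw [e1, e2, ← hm, ← hφ]
      simp
      ring
    all_goals fun_prop
  have hexp (x y : ℝ) : s ^ 2 * ((x - y) * (x * |x| - y * |y|) / 2) =
      s ^ 2 / 2 * (|x| ^ 3 + |y| ^ 3 - x * (y * |y|) - x * |x| * y) := by
    linear_combination (-s ^ 2 / 2) * (|x| * sq_abs x + |y| * sq_abs y)
  have i3 (y : ℝ) : Integrable (fun x : ℝ => |x| ^ 3 + |y| ^ 3) μ :=
    hint3.add (integrable_const _)
  have i3' (y : ℝ) : Integrable (fun x : ℝ => |x| ^ 3 + |y| ^ 3 - x * (y * |y|)) μ :=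
    (i3 y).sub (i1.mul_const _)
  have hbound (y : ℝ) : ∫ x, s ^ 2 * ((x - y) * (x * |x| - y * |y|) / 2) ∂μ =
      s ^ 2 / 2 * (β + |y| ^ 3 - y * c) := by
    simp_rw [hexp]
    rw [integral_const_mul, integral_sub (i3' y) (i2'.mul_const y),
      integral_sub (i3 y) (i1.mul_const _), integral_add hint3 (integrable_const _),
      integral_mul_const, integral_mul_const, hmean, integral_const, probReal_univ, one_smul,
      ← hβ, ← hc]
    ring
  have houter : ∫ y, ∫ x, K x y ∂μ ∂μ = 2 * (m - s * Complex.I * φ) := by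
    have hexp (y : ℝ) : (m * (1 + s * Complex.I * y) + y * h y) -
        (y * φ + y ^ 2 * (s * Complex.I * φ) + s * Complex.I * h y) =
        m + y * (m * (s * Complex.I) - φ) + y * h y + y ^ 2 * (-(s * Complex.I * φ))
          + h y * (-(s * Complex.I)) := by
      ring
    simp_rw [hinner, hexp]
    rw [integral_add, integral_add, integral_add, integral_add]
    · simp_rw [integral_mul_const]
      rw [e1, e2, ← hm, ← hφ]
      simp
      ring
    all_goals fun_prop
  have hinner_le (y : ℝ) : ‖∫ x, K x y ∂μ‖ ≤ s ^ 2 / 2 * (β + |y| ^ 3 - y * c) := by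
    rw [← hbound]
    refine norm_integral_le_of_norm_le ?_ (.of_forall fun x => hK x y)
    simp_rw [hexp]
    exact ((i3' y).sub (i2'.mul_const y)).const_mul _
  have houter_le : ‖∫ y, ∫ x, K x y ∂μ ∂μ‖ ≤ s ^ 2 * β := by
    have iβ : Integrable (fun y : ℝ => β + |y| ^ 3) μ := (integrable_const β).add hint3
    have iβ' : Integrable (fun y : ℝ => β + |y| ^ 3 - y * c) μ := iβ.sub (i1.mul_const c)
    refine (norm_integral_le_of_norm_le (iβ'.const_mul _)
      (.of_forall hinner_le)).trans_eq ?_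
    rw [integral_const_mul, integral_sub iβ (i1.mul_const c),
      integral_add (integrable_const β) hint3, integral_mul_const, hmean, integral_const,
      probReal_univ, one_smul, ← hβ]
    ring
  rw [houter, norm_mul, Complex.norm_ofNat] at houter_le
  linarith

lemma hasDerivAt_charFun (hint : Integrable (fun x : ℝ => x) μ) (s : ℝ) :
    HasDerivAt (charFun μ) (Complex.I * ∫ x : ℝ, x * Complex.exp (s * x * Complex.I) ∂μ) s := by
  have hmem : MemLp id ((1 : ℕ) : ENNReal) μ := by
    rw [Nat.cast_one, memLp_one_iff_integrable]
    exact hint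
  have hd := ((contDiff_charFun hmem).differentiable (by simp)).differentiableAt (x := s)
  have h := iteratedDeriv_charFun hmem (t := s)
  rw [iteratedDeriv_one] at h
  simpa [h] using hd.hasDerivAt

lemma norm_charFun_pow_sub_exp_le_of_nonneg
    (hmean : ∫ x, x ∂μ = 0) (hvar : ∫ x, x ^ 2 ∂μ = 1)
    (hint3 : Integrable (fun x => |x| ^ 3) μ) {n : ℕ} (hn : 1 ≤ n) {t : ℝ} (ht : 0 ≤ t) :
    ‖charFun μ (t / Real.sqrt n) ^ n - (Real.exp (-t ^ 2 / 2) : ℂ)‖ ≤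
      (∫ x, |x| ^ 3 ∂μ) / Real.sqrt n * Real.exp (-t ^ 2 / 2) *
        ∫ u in (0 : ℝ)..t, u ^ 2 / 2 * Real.exp (u ^ 2 / 2) *
          ‖charFun μ (u / Real.sqrt n)‖ ^ (n - 1) := by
  have i1 : Integrable (fun x : ℝ => x) μ := by
    refine (integrable_abs_pow_of_le_three hint3 (k := 1) (by norm_num)).mono' (by fun_prop) ?_
    simp
  set β := ∫ x, |x| ^ 3 ∂μ
  set r := Real.sqrt n
  have hr0 : 0 < r := Real.sqrt_pos.2 (by exact_mod_cast hn)
  have hrn : r ^ 2 = n := Real.sq_sqrt (by positivity)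
  have hrnC : (r : ℂ) ^ 2 = n := by exact_mod_cast hrn
  have hrC : (r : ℂ) ≠ 0 := by exact_mod_cast hr0.ne'
  set B' : ℝ → ℝ := fun u => u ^ 2 / 2 * Real.exp (u ^ 2 / 2) * ‖charFun μ (u / r)‖ ^ (n - 1)
    with hB'
  have hB'c : Continuous B' := by fun_prop
  let m : ℝ → ℂ := fun s => ∫ x : ℝ, x * Complex.exp (s * x * Complex.I) ∂μ
  let g : ℝ → ℂ := fun u => (Real.exp (u ^ 2 / 2) : ℂ) * charFun μ (u / r) ^ n - 1
  let g' : ℝ → ℂ := fun u => (Real.exp (u ^ 2 / 2) : ℂ) * charFun μ (u / r) ^ (n - 1) *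
    (r * (Complex.I * (m (u / r) - (u / r : ℝ) * Complex.I * charFun μ (u / r))))
  have hg (u : ℝ) : HasDerivAt g (g' u) u := by
    have h1 : HasDerivAt (fun u : ℝ => (Real.exp (u ^ 2 / 2) : ℂ))
        ((Real.exp (u ^ 2 / 2) * u : ℝ) : ℂ) u := by
      refine HasDerivAt.ofReal_comp ?_
      convert! (((hasDerivAt_id u).pow 2).div_const 2).exp using 1
      simp
    have h2 : HasDerivAt (fun u : ℝ => charFun μ (u / r))
        ((1 / r : ℝ) • (Complex.I * m (u / r))) u :=
      HasDerivAt.scomp (g₁ := charFun μ) u (hasDerivAt_charFun i1 (u / r)) ((hasDerivAt_id' u).div_const r)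
    convert! ((h1.mul (h2.pow n)).sub_const 1) using 1
    obtain ⟨k, rfl⟩ : ∃ k, n = k + 1 := ⟨n - 1, by omega⟩
    simp only [g', Pi.pow_apply, Nat.add_sub_cancel, Complex.real_smul, ← hrnC]
    push_cast
    field_simp
    ring_nf
    simp only [Complex.I_sq]
    ring
  have hbound (u : ℝ) : ‖g' u‖ ≤ β / r * B' u := by
    have h := norm_integral_mul_exp_sub_le hmean hvar hint3 (u / r)
    simp only [g', norm_mul, norm_pow, Complex.norm_real, Complex.norm_I, one_mul,
      Real.norm_eq_abs, Real.abs_exp, abs_of_pos hr0]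
    calc _ ≤ Real.exp (u ^ 2 / 2) * ‖charFun μ (u / r)‖ ^ (n - 1) *
          (r * ((u / r) ^ 2 * (β / 2))) := by gcongr
      _ = _ := by
        simp only [hB']
        field_simp
  have hB (u : ℝ) : HasDerivAt (fun u => β / r * ∫ v in (0 : ℝ)..u, B' v) (β / r * B' u) u :=
    (hB'c.integral_hasStrictDerivAt 0 u).hasDerivAt.const_mul _
  have hgt : ‖g t‖ ≤ β / r * ∫ v in (0 : ℝ)..t, B' v :=
    image_norm_le_of_norm_deriv_right_le_deriv_boundary
      (fun u _ => (hg u).continuousAt.continuousWithinAt)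
      (fun u _ => (hg u).hasDerivWithinAt) (by simp [g]) hB (fun u _ => hbound u)
      (Set.right_mem_Icc.2 ht)
  have hexp : Real.exp (-t ^ 2 / 2) * Real.exp (t ^ 2 / 2) = 1 := by
    rw [← Real.exp_add, neg_div, neg_add_cancel, Real.exp_zero]
  have hexpC : (Real.exp (-t ^ 2 / 2) : ℂ) * Real.exp (t ^ 2 / 2) = 1 := by exact_mod_cast hexp
  have heq : charFun μ (t / r) ^ n - (Real.exp (-t ^ 2 / 2) : ℂ) =
      (Real.exp (-t ^ 2 / 2) : ℂ) * g t := by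
    simp only [g]
    linear_combination -(charFun μ (t / r) ^ n) * hexpC
  rw [heq, norm_mul, Complex.norm_real, Real.norm_eq_abs, Real.abs_exp]
  calc _ ≤ Real.exp (-t ^ 2 / 2) * (β / r * ∫ v in (0 : ℝ)..t, B' v) := by gcongr
    _ = _ := by ring

end Moments

/-- Tyurin's estimate: for a distribution with zero mean, unit variance and third absolute
moment `β³`, with `ℓ = β³/√n`, the characteristic function `f_n(t) = (f(t/√n))ⁿ` of the
normalized sum satisfies
`|f_n(t) − e^{−t²/2}| ≤ ℓ e^{−t²/2} ∫₀^{|t|} (u²/2) e^{u²/2} |f(u/√n)|^{n−1} du`. -/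
theorem tyurin_charFun_diff_bound (μ : Measure ℝ) [IsProbabilityMeasure μ]
    (hmean : ∫ x, x ∂μ = 0) (hvar : ∫ x, x ^ 2 ∂μ = 1)
    (hint3 : Integrable (fun x => |x| ^ 3) μ)
    (β3 : ℝ) (hβ3 : β3 = ∫ x, |x| ^ 3 ∂μ)
    (f : ℝ → ℂ) (hf : ∀ t : ℝ, f t = ∫ x, Complex.exp (Complex.I * t * x) ∂μ)
    (n : ℕ) (hn : 1 ≤ n) (t : ℝ) :
    ‖(f (t / Real.sqrt n)) ^ n - (Real.exp (-t ^ 2 / 2) : ℂ)‖ ≤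
      β3 / Real.sqrt n * Real.exp (-t ^ 2 / 2) *
        ∫ u in (0 : ℝ)..|t|, u ^ 2 / 2 * Real.exp (u ^ 2 / 2) *
          ‖f (u / Real.sqrt n)‖ ^ (n - 1) := by
  obtain rfl : f = charFun μ := by
    ext s
    rw [hf, charFun_apply_real]
    congr with x
    ring_nf
  subst hβ3
  have h := norm_charFun_pow_sub_exp_le_of_nonneg hmean hvar hint3 hn (abs_nonneg t)
  rw [sq_abs] at h
  convert h using 1
  rcases abs_choice t with ht | ht
  · rw [ht]
  · rw [ht, neg_div (√n) t, charFun_neg, ← Complex.norm_conj, map_sub, map_pow, Complex.conj_ofReal]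
end
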